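/- arXiv:2212.01955 — 2 statements merged into one kernel-verified Lean document; each statement's English description precedes it below -/
import Mathlib

section
/- Exactly 637 four-digit positive integers n (1000 ≤ n ≤ 9999) have a reflective sequence entering the cycle {2178, -6534, -2178, 6534}, and exactly 8363 have a reflective sequence reaching 0; i.e., the cardinality of {n : 1000 ≤ n ≤ 9999 ∧ ∃ k, f^[k](n) = 2178} is 637 and the cardinality of {n : 1000 ≤ n ≤ 9999 ∧ ∃ k, f^[k](n) = 0} is 8363. -/
/-- Reverse the decimal digits of a natural number. -/
def rev (m : ℕ) : ℕ := Nat.ofDigits 10 (Nat.digits 10 m).reverse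

/-- The reflection of an integer: reverse its digits and flip its sign. -/
def reflect (a : ℤ) : ℤ := if 0 ≤ a then -(rev a.toNat : ℤ) else (rev (-a).toNat : ℤ)

/-- The reflective step map. -/
def f (a : ℤ) : ℤ := a + reflect a

/-- Fast reversal for numbers below ten thousand. -/
def fr (m : ℕ) : ℕ :=
  bif Nat.ble 1000 m then m % 10 * 1000 + m / 10 % 10 * 100 + m / 100 % 10 * 10 + m / 1000
  else bif Nat.ble 100 m then m % 10 * 100 + m / 10 % 10 * 10 + m / 100
  else bif Nat.ble 10 m then m % 10 * 10 + m / 10 else m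

def gstep (m : ℕ) : ℕ := (m - fr m) + (fr m - m)

/-- `true` if the trajectory of absolute values dies within `k` steps. -/
def dies : ℕ → ℕ → Bool
  | 0, m => Nat.beq m 0
  | k + 1, m => match m with
    | 0 => true
    | n + 1 => dies k (gstep (n + 1))

def cyc : ℕ → ℕ → Bool
  | 0, m => Nat.beq m 2178 || Nat.beq m 6534
  | k + 1, m => match m with
    | 0 => false
    | n + 1 => cyc k (gstep (n + 1))

def cnt (p : ℕ → Bool) : ℕ → ℕ → ℕ
  | 0, s => bif p s then 1 else 0
  | d + 1, s => cnt p d s + cnt p d (s + 2 ^ d)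

def pd (m : ℕ) : Bool := Nat.ble 1000 m && (Nat.ble m 9999 && dies 13 m)
def pc (m : ℕ) : Bool := Nat.ble 1000 m && (Nat.ble m 9999 && cyc 13 m)

theorem cnt_eq (p : ℕ → Bool) (d s : ℕ) :
    cnt p d s = ((Finset.Ico s (s + 2 ^ d)).filter (fun m => p m = true)).card := by
  induction d generalizing s with
  | zero =>
    simp only [cnt, pow_zero, Nat.Ico_succ_singleton, Finset.filter_singleton]
    cases p s <;> simp
  | succ d ih =>
    rw [cnt, ih, ih, ← Finset.card_union_of_disjoint, ← Finset.filter_union,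
      Finset.Ico_union_Ico_eq_Ico (Nat.le_add_right _ _) (Nat.le_add_right _ _)]
    · congr 3; ring
    · apply Finset.disjoint_filter_filter
      exact Finset.Ico_disjoint_Ico_consecutive _ _ _

theorem cnt_pd : cnt pd 14 0 = 8363 := by decide +kernel
theorem cnt_pc : cnt pc 14 0 = 637 := by decide +kernel

theorem rev_eq (m : ℕ) (h : m < 10000) : rev m = fr m := by
  have key : ∀ n : ℕ, n ≠ 0 → Nat.digits 10 n = n % 10 :: Nat.digits 10 (n / 10) :=
    fun n hn => Nat.digits_def' (by norm_num) (Nat.pos_of_ne_zero hn)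
  unfold rev fr
  by_cases h3 : 1000 ≤ m
  · rw [key m (by omega), key (m / 10) (by omega), key (m / 10 / 10) (by omega),
      key (m / 10 / 10 / 10) (by omega),
      show m / 10 / 10 / 10 / 10 = 0 by omega]
    simp [Nat.ofDigits_cons, Nat.ble_eq_true_of_le h3]
    have q2 : m / 100 = m / 10 / 10 := by omega
    have q3 : m / 1000 = m / 10 / 10 / 10 := by omega
    rw [q2, q3]
    omega
  by_cases h2 : 100 ≤ m
  · rw [key m (by omega), key (m / 10) (by omega), key (m / 10 / 10) (by omega),
      show m / 10 / 10 / 10 = 0 by omega]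
    have e3 : Nat.ble 1000 m = false := Bool.eq_false_iff.2 (fun h => h3 (Nat.le_of_ble_eq_true h))
    simp [Nat.ofDigits_cons, Nat.ble_eq_true_of_le h2, e3]
    omega
  have e3 : Nat.ble 1000 m = false := Bool.eq_false_iff.2 (fun h => h3 (Nat.le_of_ble_eq_true h))
  have e2 : Nat.ble 100 m = false := Bool.eq_false_iff.2 (fun h => h2 (Nat.le_of_ble_eq_true h))
  by_cases h1 : 10 ≤ m
  · rw [key m (by omega), key (m / 10) (by omega),
      show m / 10 / 10 = 0 by omega]
    simp [Nat.ofDigits_cons, Nat.ble_eq_true_of_le h1, e3, e2]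
    omega
  have e1 : Nat.ble 10 m = false := Bool.eq_false_iff.2 (fun h => h1 (Nat.le_of_ble_eq_true h))
  by_cases h0 : m = 0
  · subst h0; simp
  rw [key m h0, show m / 10 = 0 by omega]
  simp [Nat.ofDigits_cons, e1, e2, e3]
  omega

theorem fr_lt (m : ℕ) (h : m < 10000) : fr m < 10000 := by
  unfold fr
  cases Nat.ble 1000 m <;> cases Nat.ble 100 m <;> cases Nat.ble 10 m <;> simp <;> omega

theorem f_step (a : ℤ) (h : a.natAbs < 10000) : (f a).natAbs = gstep a.natAbs := by
  unfold f reflect gstep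
  split_ifs with h0
  · rw [show a.toNat = a.natAbs by omega, rev_eq _ h]; omega
  · rw [show (-a).toNat = a.natAbs by omega, rev_eq _ h]; omega

theorem gstep_lt (m : ℕ) (h : m < 10000) : gstep m < 10000 := by
  have := fr_lt m h
  unfold gstep; omega

theorem f_iter_zero (k : ℕ) : f^[k] 0 = 0 := by
  apply Function.iterate_fixed
  simp [f, reflect, rev]

theorem dies_sound (k : ℕ) (a : ℤ) (h : a.natAbs < 10000) (hd : dies k a.natAbs = true) :
    f^[k] a = 0 := by
  induction k generalizing a with
  | zero => simpa [dies] using hd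
  | succ k ih =>
    rcases hm : a.natAbs with _ | n
    · have : a = 0 := by omega
      subst this; exact f_iter_zero _
    · rw [hm] at hd
      simp only [dies] at hd
      rw [Function.iterate_succ_apply]
      rw [← hm, ← f_step a h] at hd
      exact ih _ (by rw [f_step a h]; exact gstep_lt _ h) hd

theorem cyc_sound (k : ℕ) (a : ℤ) (h : a.natAbs < 10000) (hd : cyc k a.natAbs = true) :
    (f^[k] a).natAbs = 2178 ∨ (f^[k] a).natAbs = 6534 := by
  induction k generalizing a with
  | zero => simpa [cyc] using hd
  | succ k ih =>
    rcases hm : a.natAbs with _ | n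
    · rw [hm] at hd; simp [cyc] at hd
    · rw [hm] at hd
      simp only [cyc] at hd
      rw [Function.iterate_succ_apply]
      rw [← hm, ← f_step a h] at hd
      exact ih _ (by rw [f_step a h]; exact gstep_lt _ h) hd

theorem r1 : rev 2178 = 8712 := by rw [rev_eq _ (by norm_num)]; rfl
theorem r2 : rev 6534 = 4356 := by rw [rev_eq _ (by norm_num)]; rfl
theorem f1 : f 2178 = -6534 := by
  rw [f, reflect, if_pos (by norm_num)]
  change (2178 : ℤ) + -((rev 2178 : ℕ) : ℤ) = _
  rw [r1]; norm_num
theorem f2 : f (-6534) = -2178 := by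
  rw [f, reflect, if_neg (by norm_num)]
  change ((-6534) : ℤ) + ((rev 6534 : ℕ) : ℤ) = _
  rw [r2]; norm_num
theorem f3 : f (-2178) = 6534 := by
  rw [f, reflect, if_neg (by norm_num)]
  change ((-2178) : ℤ) + ((rev 2178 : ℕ) : ℤ) = _
  rw [r1]; norm_num
theorem f4 : f 6534 = 2178 := by
  rw [f, reflect, if_pos (by norm_num)]
  change (6534 : ℤ) + -((rev 6534 : ℕ) : ℤ) = _
  rw [r2]; norm_num

theorem cyc_reach (a : ℤ) (h : a.natAbs = 2178 ∨ a.natAbs = 6534) : ∃ k, f^[k] a = 2178 := by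
  have : a = 2178 ∨ a = -2178 ∨ a = 6534 ∨ a = -6534 := by omega
  rcases this with rfl | rfl | rfl | rfl
  · exact ⟨0, rfl⟩
  · exact ⟨2, by simp [f3, f4]⟩
  · exact ⟨1, by simp [f4]⟩
  · exact ⟨3, by simp [f2, f3, f4]⟩

theorem not_both (a : ℤ) (h1 : ∃ k, f^[k] a = 2178) (h2 : ∃ k, f^[k] a = 0) : False := by
  obtain ⟨k, hk⟩ := h1
  obtain ⟨l, hl⟩ := h2
  have inv : ∀ j, (f^[j] 2178).natAbs = 2178 ∨ (f^[j] 2178).natAbs = 6534 := by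
    intro j
    induction j with
    | zero => simp
    | succ j ih =>
      rw [Function.iterate_succ_apply']
      generalize f^[j] 2178 = b at ih
      have : b = 2178 ∨ b = -2178 ∨ b = 6534 ∨ b = -6534 := by omega
      rcases this with rfl | rfl | rfl | rfl <;> simp [f1, f2, f3, f4]
  have e1 : f^[l + k] a = f^[l] 2178 := by rw [Function.iterate_add_apply, hk]
  have e2 : f^[k + l] a = 0 := by rw [Function.iterate_add_apply, hl, f_iter_zero]
  rw [add_comm, e2] at e1
  have := inv l
  rw [← e1] at this
  simp at this

theorem ncard_of (S : Set ℤ) (p : ℕ → Bool) (N : ℕ) (hc : cnt p 14 0 = N)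
    (hS : ((fun m : ℕ => (m : ℤ)) '' {m : ℕ | m < 16384 ∧ p m = true}) = S) : S.ncard = N := by
  rw [← hS, Set.ncard_image_of_injective _ Nat.cast_injective, ← hc, cnt_eq,
    ← Set.ncard_coe_finset]
  congr 1
  ext m
  simp

theorem total (m : ℕ) (h1 : 1000 ≤ m) (h2 : m ≤ 9999) : pd m = true ∨ pc m = true := by
  by_contra hcon
  set D := (Finset.Ico 0 (0 + 2 ^ 14)).filter (fun m => pd m = true) with hD
  set C := (Finset.Ico 0 (0 + 2 ^ 14)).filter (fun m => pc m = true) with hC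
  have cD : D.card = 8363 := by rw [hD, ← cnt_eq, cnt_pd]
  have cC : C.card = 637 := by rw [hC, ← cnt_eq, cnt_pc]
  have hdis : Disjoint D C := by
    rw [Finset.disjoint_left]
    intro x hx hy
    simp only [hD, hC, Finset.mem_filter, pd, pc, Bool.and_eq_true, Nat.ble_eq] at hx hy
    exact not_both x
      (by
        obtain ⟨k, hk⟩ := cyc_reach _ (cyc_sound 13 (x : ℤ) (by simp; omega) (by simpa using hy.2.2.2))
        exact ⟨k + 13, by rw [Function.iterate_add_apply, hk]⟩)
      ⟨13, dies_sound 13 (x : ℤ) (by simp; omega) (by simpa using hx.2.2.2)⟩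
  have hsub : D ∪ C ⊆ (Finset.Icc 1000 9999).erase m := by
    intro x hx
    rw [Finset.mem_union] at hx
    rw [Finset.mem_erase, Finset.mem_Icc]
    constructor
    · rintro rfl
      apply hcon
      rcases hx with hx | hx
      · exact Or.inl (Finset.mem_filter.1 hx).2
      · exact Or.inr (Finset.mem_filter.1 hx).2
    · rcases hx with hx | hx <;>
      · simp only [hD, hC, Finset.mem_filter, pd, pc, Bool.and_eq_true, Nat.ble_eq] at hx
        omega
  have := Finset.card_le_card hsub
  rw [Finset.card_union_of_disjoint hdis, cD, cC,
    Finset.card_erase_of_mem (Finset.mem_Icc.2 ⟨h1, h2⟩), Nat.card_Icc] at this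
  omega

theorem pd_spec (m : ℕ) (h : pd m = true) : 1000 ≤ m ∧ m ≤ 9999 ∧ ∃ k, f^[k] (m : ℤ) = 0 := by
  simp only [pd, Bool.and_eq_true, Nat.ble_eq] at h
  exact ⟨h.1, h.2.1, 13, dies_sound 13 (m : ℤ) (by simp; omega) (by simpa using h.2.2)⟩

theorem pc_spec (m : ℕ) (h : pc m = true) : 1000 ≤ m ∧ m ≤ 9999 ∧ ∃ k, f^[k] (m : ℤ) = 2178 := by
  simp only [pc, Bool.and_eq_true, Nat.ble_eq] at h
  refine ⟨h.1, h.2.1, ?_⟩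
  obtain ⟨k, hk⟩ := cyc_reach _ (cyc_sound 13 (m : ℤ) (by simp; omega) (by simpa using h.2.2))
  exact ⟨k + 13, by rw [Function.iterate_add_apply, hk]⟩

theorem four_digit_counts :
    {n : ℤ | 1000 ≤ n ∧ n ≤ 9999 ∧ ∃ k : ℕ, f^[k] n = 2178}.ncard = 637 ∧
    {n : ℤ | 1000 ≤ n ∧ n ≤ 9999 ∧ ∃ k : ℕ, f^[k] n = 0}.ncard = 8363 := by
  constructor
  · apply ncard_of _ pc _ cnt_pc
    ext n
    constructor
    · rintro ⟨m, ⟨-, hm⟩, rfl⟩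
      obtain ⟨h1, h2, h3⟩ := pc_spec m hm
      exact ⟨Int.ofNat_le.2 h1, Int.ofNat_le.2 h2, h3⟩
    · rintro ⟨h1, h2, h3⟩
      lift n to ℕ using by omega
      refine ⟨n, ⟨by omega, ?_⟩, rfl⟩
      rcases total n (by omega) (by omega) with h | h
      · exact (not_both _ h3 (pd_spec n h).2.2).elim
      · exact h
  · apply ncard_of _ pd _ cnt_pd
    ext n
    constructor
    · rintro ⟨m, ⟨-, hm⟩, rfl⟩
      obtain ⟨h1, h2, h3⟩ := pd_spec m hm
      exact ⟨Int.ofNat_le.2 h1, Int.ofNat_le.2 h2, h3⟩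
    · rintro ⟨h1, h2, h3⟩
      lift n to ℕ using by omega
      refine ⟨n, ⟨by omega, ?_⟩, rfl⟩
      rcases total n (by omega) (by omega) with h | h
      · exact h
      · exact (not_both _ (pc_spec n h).2.2 h3).elim
end

section
/- Among the six-digit positive integers n (100000 ≤ n ≤ 999999), exactly 460458 satisfy ∃ k, f^[k](n) = 0, exactly 241749 satisfy ∃ k, f^[k](n) = 2178, exactly 178686 satisfy ∃ k, f^[k](n) = 21978, and exactly 19107 satisfy ∃ k, f^[k](n) = 219978. -/
/-- forcing evaluation -/
def frc (n : ℕ) (k : ℕ → ℕ) : ℕ := Nat.rec (k 0) (fun m _ => k (Nat.succ m)) n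

def bc (b : Bool) (x y : ℕ) : ℕ := Bool.rec y x b

def rv : ℕ → ℕ → ℕ → ℕ := fun fuel => Nat.rec (fun _ acc => acc)
  (fun _ ih n acc => Nat.rec acc (fun m _ =>
     ih (Nat.div (Nat.succ m) 10) (Nat.add (Nat.mul acc 10) (Nat.mod (Nat.succ m) 10))) n) fuel

def adf (a b : ℕ) : ℕ := Nat.add (Nat.sub a b) (Nat.sub b a)

def enc (n : ℕ) : ℕ → ℕ := fun r =>
  bc (Nat.beq n 0) 1 (bc (Nat.beq n 2178) 1000000 (bc (Nat.beq n 21978) 1000000000000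
    (bc (Nat.beq n 219978) 1000000000000000000 r)))

def cls : ℕ → ℕ → ℕ := fun fuel => Nat.rec (fun _ => 0)
  (fun _ ih n => frc n fun n => enc n (ih (frc (rv 6 n 0) fun r => adf n r))) fuel

def sm : ℕ → (ℕ → ℕ) → ℕ := fun k F => Nat.rec 0 (fun i s => Nat.add s (F i)) k

def w (x : ℕ) : ℕ := Nat.sub 10 (adf x 9)
def w1 (x : ℕ) : ℕ := bc (Nat.ble 9 x) (bc (Nat.beq x 9) 9 (Nat.sub 19 x)) x

def tot (N : ℕ) : ℕ := sm N fun x => Nat.mul (w1 x) (sm 19 fun y => Nat.mul (w y) (sm 19 fun z =>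
  Nat.mul (w z) (cls 49 (adf (99999*x+9990*y+900*z) 998001))))

theorem frc_eq (n : ℕ) (k : ℕ → ℕ) : frc n k = k n := by cases n <;> rfl

theorem bc_eq (b : Bool) (x y : ℕ) : bc b x y = if b = true then x else y := by cases b <;> rfl

theorem rv_zero (n acc : ℕ) : rv 0 n acc = acc := rfl

theorem rv_succ (k n acc : ℕ) :
    rv (k+1) n acc = if n = 0 then acc else rv k (n/10) (acc*10+n%10) := by
  cases n <;> rfl

theorem rv_foldl (k : ℕ) : ∀ n acc : ℕ, n < 10^k →
    rv k n acc = (Nat.digits 10 n).foldl (fun a d => a*10+d) acc := by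
  induction k with
  | zero => intro n acc h; have : n = 0 := by simpa using h
            subst this; simp [rv_zero]
  | succ k ih =>
    intro n acc h
    rw [rv_succ]
    split_ifs with h0
    · subst h0; simp
    · rw [Nat.digits_def' (by norm_num) (by omega), List.foldl_cons, ih]
      rw [pow_succ] at h; omega

theorem rev_eq_s14 (n : ℕ) (h : n < 1000000) : rev n = rv 6 n 0 := by
  rw [rv_foldl 6 n 0 (by simpa using h), rev, Nat.ofDigits_eq_foldr, List.foldr_reverse]
  congr 1
  funext a d
  simp; ring

theorem rev_lt (n : ℕ) (h : n < 1000000) : rev n < 1000000 := by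
  have h1 : rev n < 10 ^ (Nat.digits 10 n).reverse.length := by
    apply Nat.ofDigits_lt_base_pow_length (by norm_num)
    intro x hx
    exact Nat.digits_lt_base (by norm_num) (List.mem_reverse.1 hx)
  have h2 : (Nat.digits 10 n).length ≤ 6 := by
    rw [Nat.digits_length_le_iff (by norm_num)]; simpa using h
  rw [List.length_reverse] at h1
  exact h1.trans_le (by simpa using Nat.pow_le_pow_right (n := 10) (by norm_num) h2)

theorem adf_eq (a b : ℕ) : adf a b = (a - b) + (b - a) := rfl

def gg (n : ℕ) : ℕ := adf n (rev n)

theorem gg_lt (n : ℕ) (h : n < 1000000) : gg n < 1000000 := by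
  have := rev_lt n h
  rw [gg, adf_eq]; omega

theorem gg_eq (n : ℕ) (h : n < 1000000) : gg n = adf n (rv 6 n 0) := by rw [gg, rev_eq_s14 n h]

theorem f_natAbs (a : ℤ) : (f a).natAbs = gg a.natAbs := by
  unfold f reflect gg
  rw [adf_eq]
  split_ifs with h
  · have : a.toNat = a.natAbs := by omega
    rw [this]; omega
  · have : (-a).toNat = a.natAbs := by omega
    rw [this]; omega

theorem iter_natAbs (k : ℕ) (a : ℤ) : (f^[k] a).natAbs = gg^[k] a.natAbs :=
  (Function.Semiconj.iterate_right (f := Int.natAbs) (ga := f) (gb := gg) f_natAbs k) a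

def four (c : ℕ) : Prop := c = 0 ∨ c = 2178 ∨ c = 21978 ∨ c = 219978

theorem gg_c {c : ℕ} (h : four c) : gg c = 3 * c ∧ gg (3 * c) = c := by
  rcases h with h | h | h | h <;> subst h <;>
    exact ⟨by rw [gg_eq _ (by norm_num)]; decide +kernel,
      by rw [gg_eq _ (by norm_num)]; decide +kernel⟩

theorem orb {c : ℕ} (h : four c) (j : ℕ) : gg^[j] c = c ∨ gg^[j] c = 3 * c := by
  induction j with
  | zero => left; rfl
  | succ j ih =>
    rw [Function.iterate_succ_apply']
    rcases ih with ih | ih <;> rw [ih]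
    · right; exact (gg_c h).1
    · left; exact (gg_c h).2

theorem f_nat (n : ℕ) : f (n:ℤ) = n - rev n := by
  simp [f, reflect]; ring

theorem f_neg (n : ℕ) (h : 0 < n) : f (-(n:ℤ)) = - n + rev n := by
  simp only [f, reflect]
  rw [if_neg (by omega), neg_neg, Int.toNat_natCast]

theorem rev_c {c : ℕ} (h : four c) : rev c = 4 * c ∧ rev (3 * c) = 2 * c := by
  rcases h with h | h | h | h <;> subst h <;>
    exact ⟨by rw [rev_eq_s14 _ (by norm_num)]; decide +kernel,
      by rw [rev_eq_s14 _ (by norm_num)]; decide +kernel⟩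

theorem f_neg_c {c : ℕ} (h : four c) : f (f (-(c:ℤ))) = c := by
  rcases Nat.eq_zero_or_pos c with h0 | h0
  · subst h0
    have := f_nat 0
    rw [(rev_c h).1] at this
    norm_num at this ⊢
    rw [this, this]
  · have h1 : f (-(c:ℤ)) = ((3 * c : ℕ) : ℤ) := by
      rw [f_neg c h0, (rev_c h).1]; push_cast; ring
    rw [h1, f_nat, (rev_c h).2]; push_cast; ring

def PP (c n : ℕ) : Prop := ∃ k, gg^[k] n = c

theorem PP_iff {c : ℕ} (h : four c) (n : ℕ) : (∃ k : ℕ, f^[k] (n:ℤ) = c) ↔ PP c n := by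
  constructor
  · rintro ⟨k, hk⟩
    refine ⟨k, ?_⟩
    have := iter_natAbs k n
    rw [hk] at this
    simpa using this.symm
  · rintro ⟨k, hk⟩
    have := iter_natAbs k n
    rw [Int.natAbs_natCast, hk] at this
    rcases Int.natAbs_eq (f^[k] (n:ℤ)) with h1 | h1
    · exact ⟨k, by rw [h1, this]⟩
    · refine ⟨k+2, ?_⟩
      rw [Function.iterate_succ_apply', Function.iterate_succ_apply', h1, this, f_neg_c h]

theorem PP_gg {c : ℕ} (h : four c) (n : ℕ) : PP c n ↔ PP c (gg n) := by
  constructor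
  · rintro ⟨k, hk⟩
    refine ⟨k+1, ?_⟩
    rw [← Function.iterate_succ_apply, Function.iterate_succ_apply', Function.iterate_succ_apply',
      hk, (gg_c h).1, (gg_c h).2]
  · rintro ⟨k, hk⟩
    exact ⟨k+1, by rw [Function.iterate_succ_apply, hk]⟩

theorem PP_aux {c d n k l : ℕ} (hc : four c) (hd : four d) (hk : gg^[k] n = c)
    (hl : gg^[l] n = d) (hkl : k ≤ l) : c = d := by
  obtain ⟨j, rfl⟩ := Nat.exists_eq_add_of_le' hkl
  rw [Function.iterate_add_apply, hk] at hl
  have := orb hc j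
  rw [hl] at this
  unfold four at hc hd
  omega

theorem PP_unique {c d n : ℕ} (hc : four c) (hd : four d) (h1 : PP c n) (h2 : PP d n) : c = d := by
  obtain ⟨k, hk⟩ := h1
  obtain ⟨l, hl⟩ := h2
  rcases le_total k l with h | h
  · exact PP_aux hc hd hk hl h
  · exact (PP_aux hd hc hl hk h).symm

theorem cls_succ (k n : ℕ) (h : n < 1000000) : cls (k+1) n = enc n (cls k (gg n)) := by
  have : cls (k+1) n =
    frc n fun n => enc n (cls k (frc (rv 6 n 0) fun r => adf n r)) := rfl
  rw [this, frc_eq, frc_eq, gg_eq n h]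

theorem enc_eq (n r : ℕ) : enc n r = if n = 0 then 1 else if n = 2178 then 1000000 else
    if n = 21978 then 1000000000000 else if n = 219978 then 1000000000000000000 else r := by
  simp only [enc, bc_eq, Nat.beq_eq]

theorem cls_spec (k : ℕ) : ∀ n, n < 1000000 → cls k n = 0 ∨ (cls k n = 1 ∧ PP 0 n) ∨
    (cls k n = 1000000 ∧ PP 2178 n) ∨ (cls k n = 1000000000000 ∧ PP 21978 n) ∨
    (cls k n = 1000000000000000000 ∧ PP 219978 n) := by
  induction k with
  | zero => intro n _; left; rfl
  | succ k ih =>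
    intro n h
    rw [cls_succ k n h, enc_eq]
    split_ifs with h1 h2 h3 h4
    · exact Or.inr (Or.inl ⟨rfl, 0, h1⟩)
    · exact Or.inr (Or.inr (Or.inl ⟨rfl, 0, h2⟩))
    · exact Or.inr (Or.inr (Or.inr (Or.inl ⟨rfl, 0, h3⟩)))
    · exact Or.inr (Or.inr (Or.inr (Or.inr ⟨rfl, 0, h4⟩)))
    · have := ih (gg n) (gg_lt n h)
      rwa [PP_gg (c := 0) (by simp [four]), PP_gg (c := 2178) (by simp [four]),
        PP_gg (c := 21978) (by simp [four]), PP_gg (c := 219978) (by simp [four])]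

theorem sm_eq (k : ℕ) (F : ℕ → ℕ) : sm k F = ∑ i ∈ Finset.range k, F i := by
  induction k with
  | zero => rfl
  | succ k ih => rw [Finset.sum_range_succ, ← ih]; rfl

theorem sum_ten (a : ℕ) (F : ℕ → ℕ) : ∑ n ∈ Finset.range (a*10), F n =
    ∑ i ∈ Finset.range a, ∑ j ∈ Finset.range 10, F (10*i+j) := by
  induction a with
  | zero => simp
  | succ a ih =>
    rw [Finset.sum_range_succ, ← ih, Nat.succ_mul, Finset.sum_range_add, Nat.mul_comm a 10]

theorem reg (H : ℕ → ℕ) : ∑ c ∈ Finset.range 10, ∑ d ∈ Finset.range 10, H (c+9-d) =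
    ∑ z ∈ Finset.range 19, w z * H z := by
  simp only [Finset.sum_range_succ, Finset.sum_range_zero, w, adf_eq]
  norm_num
  ring

theorem reg1 (H : ℕ → ℕ) : ∑ c ∈ Finset.range 9, ∑ d ∈ Finset.range 10, H (c+10-d) =
    ∑ z ∈ Finset.range 19, w1 z * H z := by
  simp only [Finset.sum_range_succ, Finset.sum_range_zero, w1, bc_eq, Nat.beq_eq, Nat.ble_eq]
  norm_num
  ring

theorem rv_step (k m d acc : ℕ) (hm : 0 < m) (hd : d < 10) :
    rv (k+1) (10*m+d) acc = rv k m (acc*10+d) := by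
  rw [rv_succ, if_neg (by omega)]
  congr 1 <;> omega

theorem rv_digits (a b c d e g : ℕ) (ha : 0 < a) (ha' : a < 10) (hb : b < 10) (hc : c < 10)
    (hd : d < 10) (he : e < 10) (hg : g < 10) :
    rv 6 (10*(10*(10*(10*(10*a+b)+c)+d)+e)+g) 0 = 100000*g+10000*e+1000*d+100*c+10*b+a := by
  rw [rv_step 5 (10*(10*(10*(10*a+b)+c)+d)+e) g 0 (by omega) hg,
    rv_step 4 (10*(10*(10*a+b)+c)+d) e _ (by omega) he,
    rv_step 3 (10*(10*a+b)+c) d _ (by omega) hd,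
    rv_step 2 (10*a+b) c _ (by omega) hc,
    rv_step 1 a b _ (by omega) hb,
    rv_succ 0 a, if_neg (by omega), rv_zero, Nat.mod_eq_of_lt ha']
  ring

theorem adf_congr {a b c d : ℕ} (h : a + d = c + b) : adf a b = adf c d := by
  rw [adf_eq, adf_eq]; omega

theorem gg_digits (a b c d e g : ℕ) (ha : a < 9) (hb : b < 10) (hc : c < 10) (hd : d < 10)
    (he : e < 10) (hg : g < 10) :
    gg (100000 + (10*(10*(10*(10*(10*a+b)+c)+d)+e)+g)) =
      adf (99999*(a+10-g)+9990*(b+9-e)+900*(c+9-d)) 998001 := by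
  have e1 : 100000 + (10*(10*(10*(10*(10*a+b)+c)+d)+e)+g) =
    10*(10*(10*(10*(10*(a+1)+b)+c)+d)+e)+g := by ring
  have hx : (a+10-g) + g = a + 10 := by omega
  have hy : (b+9-e) + e = b + 9 := by omega
  have hz : (c+9-d) + d = c + 9 := by omega
  generalize a+10-g = x at *
  generalize b+9-e = y at *
  generalize c+9-d = z at *
  rw [e1]
  have hlt : 10*(10*(10*(10*(10*(a+1)+b)+c)+d)+e)+g < 1000000 := by omega
  have hr := rv_digits (a+1) b c d e g (by omega) (by omega) hb hc hd he hg
  rw [gg_eq _ hlt, hr]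
  apply adf_congr
  omega

def KK (x y z : ℕ) : ℕ := cls 49 (adf (99999*x+9990*y+900*z) 998001)

def FF (i : ℕ) : ℕ := cls 49 (gg (100000 + i))

theorem sum_FF : ∑ i ∈ Finset.range 900000, FF i = tot 19 := by
  have h1 : ∑ i ∈ Finset.range 900000, FF i =
      ∑ a ∈ Finset.range 9, ∑ b ∈ Finset.range 10, ∑ c ∈ Finset.range 10,
      ∑ d ∈ Finset.range 10, ∑ e ∈ Finset.range 10, ∑ g ∈ Finset.range 10,
        KK (a+10-g) (b+9-e) (c+9-d) := by
    rw [show 900000 = 9*10*10*10*10*10 by norm_num]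
    simp only [sum_ten]
    refine Finset.sum_congr rfl fun a ha => Finset.sum_congr rfl fun b hb =>
      Finset.sum_congr rfl fun c hc => Finset.sum_congr rfl fun d hd =>
      Finset.sum_congr rfl fun e he => Finset.sum_congr rfl fun g hg => ?_
    rw [Finset.mem_range] at ha hb hc hd he hg
    rw [FF, KK, gg_digits a b c d e g ha hb hc hd he hg]
  have h2 : ∀ a b, ∑ c ∈ Finset.range 10,
      ∑ d ∈ Finset.range 10, ∑ e ∈ Finset.range 10, ∑ g ∈ Finset.range 10,
        KK (a+10-g) (b+9-e) (c+9-d) =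
      ∑ e ∈ Finset.range 10, ∑ g ∈ Finset.range 10,
        ∑ z ∈ Finset.range 19, w z * KK (a+10-g) (b+9-e) z := by
    intro a b
    rw [reg (fun z => ∑ e ∈ Finset.range 10, ∑ g ∈ Finset.range 10, KK (a+10-g) (b+9-e) z)]
    simp only [Finset.mul_sum]
    rw [Finset.sum_comm]
    refine Finset.sum_congr rfl fun e _ => ?_
    rw [Finset.sum_comm]
  have h3 : ∀ a, ∑ b ∈ Finset.range 10, ∑ e ∈ Finset.range 10, ∑ g ∈ Finset.range 10,
        ∑ z ∈ Finset.range 19, w z * KK (a+10-g) (b+9-e) z =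
      ∑ g ∈ Finset.range 10, ∑ y ∈ Finset.range 19, w y *
        ∑ z ∈ Finset.range 19, w z * KK (a+10-g) y z := by
    intro a
    rw [reg (fun y => ∑ g ∈ Finset.range 10, ∑ z ∈ Finset.range 19, w z * KK (a+10-g) y z),
      Finset.sum_comm]
    refine Finset.sum_congr rfl fun y _ => ?_
    rw [Finset.mul_sum]
  rw [h1]
  simp only [h2, h3]
  rw [reg1 (fun x => ∑ y ∈ Finset.range 19, w y * ∑ z ∈ Finset.range 19, w z * KK x y z)]
  simp only [tot, sm_eq]
  rfl

theorem tot_val : tot 19 = 19107178686241749460458 := by decide +kernel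

open Classical in
theorem ncard_eq {c : ℕ} (h : four c) :
    {n : ℤ | 100000 ≤ n ∧ n ≤ 999999 ∧ ∃ k : ℕ, f^[k] n = (c:ℤ)}.ncard =
      ∑ i ∈ Finset.range 900000, if PP c (gg (100000 + i)) then 1 else 0 := by
  rw [← Finset.card_filter, ← Set.ncard_coe_finset,
    ← Set.ncard_image_of_injective (f := fun i : ℕ => ((100000 + i : ℕ) : ℤ)) _
      (by intro x y hxy; simpa using hxy)]
  congr 1
  ext n
  simp only [Set.mem_ofPred_eq, Set.mem_image, Finset.coe_filter, Finset.mem_range]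
  constructor
  · rintro ⟨h1, h2, h3⟩
    have e : ((100000 + (n - 100000).toNat : ℕ) : ℤ) = n := by omega
    refine ⟨(n - 100000).toNat, ⟨by omega, ?_⟩, e⟩
    rw [← PP_gg h, ← PP_iff h, e]
    exact h3
  · rintro ⟨i, ⟨h1, h2⟩, rfl⟩
    rw [← PP_gg h, ← PP_iff h] at h2
    exact ⟨by omega, by omega, h2⟩

theorem FF_spec (i : ℕ) (h : i < 900000) : FF i = 0 ∨ (FF i = 1 ∧ PP 0 (gg (100000 + i))) ∨
    (FF i = 1000000 ∧ PP 2178 (gg (100000 + i))) ∨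
    (FF i = 1000000000000 ∧ PP 21978 (gg (100000 + i))) ∨
    (FF i = 1000000000000000000 ∧ PP 219978 (gg (100000 + i))) :=
  cls_spec 49 (gg (100000 + i)) (gg_lt _ (by omega))

open Classical in
theorem excl (n : ℕ) : (if PP 0 n then 1 else 0) + (if PP 2178 n then 1 else 0)
    + (if PP 21978 n then 1 else 0) + (if PP 219978 n then 1 else 0) ≤ 1 := by
  have u01 : PP 0 n → PP 2178 n → False := fun s t =>
    absurd (PP_unique (by simp [four]) (by simp [four]) s t) (by norm_num)
  have u02 : PP 0 n → PP 21978 n → False := fun s t =>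
    absurd (PP_unique (by simp [four]) (by simp [four]) s t) (by norm_num)
  have u03 : PP 0 n → PP 219978 n → False := fun s t =>
    absurd (PP_unique (by simp [four]) (by simp [four]) s t) (by norm_num)
  have u12 : PP 2178 n → PP 21978 n → False := fun s t =>
    absurd (PP_unique (by simp [four]) (by simp [four]) s t) (by norm_num)
  have u13 : PP 2178 n → PP 219978 n → False := fun s t =>
    absurd (PP_unique (by simp [four]) (by simp [four]) s t) (by norm_num)
  have u23 : PP 21978 n → PP 219978 n → False := fun s t =>
    absurd (PP_unique (by simp [four]) (by simp [four]) s t) (by norm_num)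
  generalize PP 0 n = a0 at *
  generalize PP 2178 n = a1 at *
  generalize PP 21978 n = a2 at *
  generalize PP 219978 n = a3 at *
  split_ifs <;> first | omega | (exfalso; tauto)

theorem arith (d0 d1 d2 d3 c0 c1 c2 c3 : ℕ) (hs : 19107178686241749460458 =
      d0 + 1000000 * d1 + 1000000000000 * d2 + 1000000000000000000 * d3)
    (l0 : d0 ≤ c0) (l1 : d1 ≤ c1) (l2 : d2 ≤ c2) (l3 : d3 ≤ c3)
    (hC : c0 + c1 + c2 + c3 ≤ 900000) :
    c0 = 460458 ∧ c1 = 241749 ∧ c2 = 178686 ∧ c3 = 19107 := by omega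

open Classical in
theorem le_cnt (s : Finset ℕ) (F : ℕ → ℕ) (Q : ℕ → Prop) (v : ℕ) (h : ∀ i ∈ s, F i = v → Q i) :
    ∑ i ∈ s, (if F i = v then 1 else 0) ≤ ∑ i ∈ s, if Q i then 1 else 0 := by
  refine Finset.sum_le_sum fun i hi => ?_
  by_cases hv : F i = v
  · rw [if_pos hv, if_pos (h i hi hv)]
  · rw [if_neg hv]; exact Nat.zero_le _

open Classical in
theorem core (s : Finset ℕ) (F h : ℕ → ℕ) (hcard : s.card = 900000)
    (spec : ∀ i ∈ s, F i = 0 ∨ (F i = 1 ∧ PP 0 (h i)) ∨ (F i = 1000000 ∧ PP 2178 (h i)) ∨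
      (F i = 1000000000000 ∧ PP 21978 (h i)) ∨ (F i = 1000000000000000000 ∧ PP 219978 (h i)))
    (hsum : ∑ i ∈ s, F i = 19107178686241749460458) :
    (∑ i ∈ s, (if PP 0 (h i) then 1 else 0)) = 460458 ∧
    (∑ i ∈ s, (if PP 2178 (h i) then 1 else 0)) = 241749 ∧
    (∑ i ∈ s, (if PP 21978 (h i) then 1 else 0)) = 178686 ∧
    (∑ i ∈ s, (if PP 219978 (h i) then 1 else 0)) = 19107 := by
  have hs : ∑ i ∈ s, F i =
      ∑ i ∈ s, ((if F i = 1 then 1 else 0)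
       + 1000000 * (if F i = 1000000 then 1 else 0)
       + 1000000000000 * (if F i = 1000000000000 then 1 else 0)
       + 1000000000000000000 * (if F i = 1000000000000000000 then 1 else 0)) := by
    refine Finset.sum_congr rfl fun i hi => ?_
    rcases spec i hi with h | ⟨h, _⟩ | ⟨h, _⟩ | ⟨h, _⟩ | ⟨h, _⟩ <;> rw [h] <;> norm_num
  rw [hsum] at hs
  simp only [Finset.sum_add_distrib, ← Finset.mul_sum] at hs
  have l0 := le_cnt s F (fun i => PP 0 (h i)) 1 (by
    intro i hi hv
    rcases spec i hi with h | ⟨h, p⟩ | ⟨h, p⟩ | ⟨h, p⟩ | ⟨h, p⟩ <;>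
      first | exact p | (exfalso; rw [hv] at h; norm_num at h))
  have l1 := le_cnt s F (fun i => PP 2178 (h i)) 1000000 (by
    intro i hi hv
    rcases spec i hi with h | ⟨h, p⟩ | ⟨h, p⟩ | ⟨h, p⟩ | ⟨h, p⟩ <;>
      first | exact p | (exfalso; rw [hv] at h; norm_num at h))
  have l2 := le_cnt s F (fun i => PP 21978 (h i)) 1000000000000 (by
    intro i hi hv
    rcases spec i hi with h | ⟨h, p⟩ | ⟨h, p⟩ | ⟨h, p⟩ | ⟨h, p⟩ <;>
      first | exact p | (exfalso; rw [hv] at h; norm_num at h))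
  have l3 := le_cnt s F (fun i => PP 219978 (h i)) 1000000000000000000 (by
    intro i hi hv
    rcases spec i hi with h | ⟨h, p⟩ | ⟨h, p⟩ | ⟨h, p⟩ | ⟨h, p⟩ <;>
      first | exact p | (exfalso; rw [hv] at h; norm_num at h))
  have hC := Finset.sum_le_sum fun i (_ : i ∈ s) => excl (h i)
  simp only [Finset.sum_add_distrib, Finset.sum_const, hcard, smul_eq_mul, mul_one] at hC
  exact arith _ _ _ _ _ _ _ _ hs l0 l1 l2 l3 hC

theorem six_digit_counts :
    {n : ℤ | 100000 ≤ n ∧ n ≤ 999999 ∧ ∃ k : ℕ, f^[k] n = 0}.ncard = 460458 ∧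
    {n : ℤ | 100000 ≤ n ∧ n ≤ 999999 ∧ ∃ k : ℕ, f^[k] n = 2178}.ncard = 241749 ∧
    {n : ℤ | 100000 ≤ n ∧ n ≤ 999999 ∧ ∃ k : ℕ, f^[k] n = 21978}.ncard = 178686 ∧
    {n : ℤ | 100000 ≤ n ∧ n ≤ 999999 ∧ ∃ k : ℕ, f^[k] n = 219978}.ncard = 19107 := by
  classical
  have q0 : four 0 := by simp [four]
  have q1 : four 2178 := by simp [four]
  have q2 : four 21978 := by simp [four]
  have q3 : four 219978 := by simp [four]
  have n0 := ncard_eq q0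
  have n1 := ncard_eq q1
  have n2 := ncard_eq q2
  have n3 := ncard_eq q3
  push_cast at n0 n1 n2 n3
  rw [n0, n1, n2, n3]
  exact core (Finset.range 900000) FF (fun i => gg (100000 + i)) (Finset.card_range _)
    (fun i hi => FF_spec i (Finset.mem_range.1 hi)) (sum_FF.trans tot_val)
end
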